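/- Let m > 0 and d̂ > m + 1. Given 2π-periodic continuous functions φ, ψ with ∫₀^{2π} ψ = 0, the coupled periodic ODE system f'' − (m+1)f − g' + d̂(f + g') = φ, g + f' − g − d̂(f' + g'') = ψ on (0,2π) with periodic boundary conditions for f, f', g, g' has a unique solution (f,g) with ∫₀^{2π} g = 0, and it satisfies ‖f‖_{C²} + ‖g‖_{C²} ≤ C(‖φ‖_{C⁰} + ‖ψ‖_{C⁰}) with C independent of d̂ for d̂ large. -/

import Mathlib

open Real intervalIntegral

/-- `(f, g)` is a (periodic, `C²`) solution of the coupled system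
`-(m+1)f + (f'' - g') + d̂(f + g') = φ`,
`g + (f' - g) - d̂(f' + g'') = ψ`, with `∫₀^{2π} g = 0`. -/
def IsPeriodicSol (m dhat : ℝ) (φ ψ f g : ℝ → ℝ) : Prop :=
  ContDiff ℝ 2 f ∧ ContDiff ℝ 2 g ∧
  (∀ θ : ℝ, f (θ + 2 * π) = f θ) ∧ (∀ θ : ℝ, g (θ + 2 * π) = g θ) ∧
  (∀ θ : ℝ,
    -(m + 1) * f θ + (deriv (deriv f) θ - deriv g θ) + dhat * (f θ + deriv g θ) = φ θ) ∧
  (∀ θ : ℝ,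
    g θ + (deriv f θ - g θ) - dhat * (deriv f θ + deriv (deriv g) θ) = ψ θ) ∧
  (∫ θ in (0 : ℝ)..(2 * π), g θ) = 0


lemma first_order (l : ℂ) (hl : l = 0 ∨ Complex.exp (2 * π * l) ≠ 1) (R : ℝ → ℂ)
    (hR : Continuous R) (hp : ∀ θ, R (θ + 2 * π) = R θ) (h0 : (∫ θ in (0:ℝ)..(2*π), R θ) = 0) :
    ∃ y : ℝ → ℂ, (∀ θ, HasDerivAt y (l * y θ + R θ) θ) ∧ (∀ θ, y (θ + 2 * π) = y θ) ∧
      (∫ θ in (0:ℝ)..(2*π), y θ) = 0 := by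
  have hexp : ∀ (c : ℂ) (θ : ℝ), HasDerivAt (fun t : ℝ => Complex.exp (c * t)) (c * Complex.exp (c * θ)) θ := by
    intro c θ
    have h1 : HasDerivAt (fun t : ℂ => Complex.exp (c * t)) (Complex.exp (c * θ) * (c * 1)) (θ : ℂ) :=
      ((hasDerivAt_id (θ : ℂ)).const_mul c).cexp
    have := h1.comp_ofReal
    exact this.congr_deriv (by ring)
  set J : ℝ → ℂ := fun θ => ∫ s in (0:ℝ)..θ, Complex.exp (-l * s) * R s with hJ
  have hJd : ∀ θ : ℝ, HasDerivAt J (Complex.exp (-l * θ) * R θ) θ := by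
    intro θ
    have hc : Continuous (fun s : ℝ => Complex.exp (-l * s) * R s) := by fun_prop
    exact integral_hasDerivAt_right (hc.intervalIntegrable _ _)
      (hc.stronglyMeasurableAtFilter _ _) hc.continuousAt
  have hinv : ∀ θ : ℝ, Complex.exp (l * θ) * Complex.exp (-l * θ) = 1 := by
    intro θ; rw [← Complex.exp_add]; simp
  -- solutions
  have hy : ∀ (a : ℂ) (θ : ℝ), HasDerivAt (fun t : ℝ => Complex.exp (l * t) * (a + J t))
      (l * (Complex.exp (l * θ) * (a + J θ)) + R θ) θ := by
    intro a θ
    refine ((hexp l θ).mul ((hJd θ).const_add a)).congr_deriv ?_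
    linear_combination (R θ) * hinv θ
  have hper : ∀ y : ℝ → ℂ, (∀ θ, HasDerivAt y (l * y θ + R θ) θ) → y (2 * π) = y 0 →
      ∀ θ, y (θ + 2 * π) = y θ := by
    intro y hy h θ
    have hd : ∀ t, HasDerivAt (fun t : ℝ => Complex.exp (-l * t) * (y (t + 2 * π) - y t)) 0 t := by
      intro t
      have h2 : HasDerivAt (fun t : ℝ => y (t + 2 * π)) (l * y (t + 2 * π) + R (t + 2 * π)) t :=
        (hy (t + 2 * π)).comp_add_const t (2 * π)
      refine ((hexp (-l) t).mul (h2.sub (hy t))).congr_deriv ?_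
      simp only [Pi.sub_apply]
      rw [hp t]
      ring
    have hcst := is_const_of_deriv_eq_zero (fun t => (hd t).differentiableAt)
      (fun t => (hd t).deriv) θ 0
    simp only [zero_add, h, sub_self, mul_zero] at hcst
    rcases mul_eq_zero.mp hcst with h3 | h3
    · exact absurd h3 (Complex.exp_ne_zero _)
    · exact sub_eq_zero.mp h3
  have hycont : ∀ y : ℝ → ℂ, (∀ θ, HasDerivAt y (l * y θ + R θ) θ) → Continuous y := by
    intro y hy
    exact continuous_iff_continuousAt.mpr fun t => (hy t).continuousAt
  by_cases hl0 : l = 0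
  · subst hl0
    have hc : Continuous J := continuous_iff_continuousAt.mpr fun t => (hJd t).continuousAt
    set A : ℂ := ∫ θ in (0:ℝ)..(2*π), J θ with hA
    have hd : ∀ θ, HasDerivAt (fun t => -(A / (2 * π)) + J t) (0 * (-(A / (2 * π)) + J θ) + R θ) θ := by
      intro θ
      exact ((hJd θ).const_add (-(A / (2 * π)))).congr_deriv (by simp)
    refine ⟨_, hd, hper _ hd ?_, ?_⟩
    · simp [hJ, h0]
    · rw [integral_add (by simp) (hc.intervalIntegrable _ _), ← hA]
      simp
  · have he : Complex.exp (2 * π * l) ≠ 1 := by tauto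
    have he' : 1 - Complex.exp (2 * π * l) ≠ 0 := sub_ne_zero.mpr (Ne.symm he)
    set a : ℂ := Complex.exp (2 * π * l) * J (2 * π) / (1 - Complex.exp (2 * π * l)) with ha
    have hJ0 : J 0 = 0 := by simp [hJ]
    have hP : Complex.exp (l * ((2 * π : ℝ) : ℂ)) * (a + J (2 * π)) = Complex.exp (l * ((0 : ℝ) : ℂ)) * (a + J 0) := by
      rw [hJ0]
      have : l * ((2 * π : ℝ) : ℂ) = 2 * π * l := by push_cast; ring
      rw [this, ha]
      simp
      field_simp
      ring
    have hpy := hper _ (hy a) hP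
    refine ⟨_, hy a, hpy, ?_⟩
    have hc := hycont _ (hy a)
    have h1 := integral_eq_sub_of_hasDerivAt (a := 0) (b := 2 * π) (fun t _ => hy a t)
      ((by fun_prop : Continuous _).intervalIntegrable _ _)
    rw [integral_add (((hc.const_mul l)).intervalIntegrable _ _) (hR.intervalIntegrable _ _), h0,
      integral_const_mul, hP, sub_self, add_zero] at h1
    exact (mul_eq_zero.mp h1).resolve_left hl0

lemma second_order (k : ℝ) (hk : -1 < k) (R : ℝ → ℝ)
    (hR : Continuous R) (hp : ∀ θ, R (θ + 2 * π) = R θ) (h0 : (∫ θ in (0:ℝ)..(2*π), R θ) = 0) :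
    ∃ u v : ℝ → ℝ, (∀ θ, HasDerivAt u (v θ) θ) ∧ (∀ θ, HasDerivAt v (k * u θ + R θ) θ) ∧
      (∀ θ, u (θ + 2 * π) = u θ) ∧ (∀ θ, v (θ + 2 * π) = v θ) ∧
      (∫ θ in (0:ℝ)..(2*π), u θ) = 0 ∧ (∫ θ in (0:ℝ)..(2*π), v θ) = 0 := by
  obtain ⟨l, hl⟩ := IsAlgClosed.exists_pow_nat_eq (k : ℂ) (n := 2) (by norm_num)
  have key : ∀ z : ℂ, z ^ 2 = k → z = 0 ∨ Complex.exp (2 * π * z) ≠ 1 := by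
    intro z hz
    by_contra! hcon
    obtain ⟨hz0, he⟩ := hcon
    obtain ⟨n, hn⟩ := Complex.exp_eq_one_iff.mp he
    have hzn : z = n * Complex.I := by
      have : (2 * (π : ℂ)) ≠ 0 := by simp [Real.pi_ne_zero]
      apply mul_left_cancel₀ this
      rw [hn]; ring
    have h2 : (k : ℂ) = ((-(n : ℝ) ^ 2 : ℝ) : ℂ) := by
      rw [← hz, hzn, mul_pow, Complex.I_sq]; push_cast; ring
    have h3 : k = -(n : ℝ) ^ 2 := by exact_mod_cast h2
    have h4 : (n : ℝ) ^ 2 < 1 := by linarith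
    have h5 : n ^ 2 < 1 := by exact_mod_cast h4
    have h6 : n = 0 := by nlinarith [sq_nonneg n, pow_eq_zero_iff (two_ne_zero) (a := n)]
    apply hz0; rw [hzn, h6]; simp
  obtain ⟨y, hy, hyp, hy0⟩ := first_order l (key l hl) (fun θ => (R θ : ℂ)) (by fun_prop)
    (fun θ => by simp [hp]) (by rw [intervalIntegral.integral_ofReal, h0]; simp)
  have hyc : Continuous y := continuous_iff_continuousAt.mpr fun t => (hy t).continuousAt
  obtain ⟨x, hx, hxp, hx0⟩ := first_order (-l) (key (-l) (by rw [neg_sq, hl])) y hyc hyp hy0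
  have hxc : Continuous x := continuous_iff_continuousAt.mpr fun t => (hx t).continuousAt
  have hre : ∀ w : ℝ → ℂ, Continuous w → (∫ θ in (0:ℝ)..(2*π), w θ) = 0 →
      (∫ θ in (0:ℝ)..(2*π), (w θ).re) = 0 := by
    intro w hw h
    have := Complex.reCLM.intervalIntegral_comp_comm (hw.intervalIntegrable (μ := MeasureTheory.volume) 0 (2 * π))
    simpa [h] using this
  have hred : ∀ (w : ℝ → ℂ) (w' : ℂ) (θ : ℝ), HasDerivAt w w' θ → HasDerivAt (fun t => (w t).re) w'.re θ := by
    intro w w' θ h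
    exact Complex.reCLM.hasFDerivAt.comp_hasDerivAt θ h
  refine ⟨fun θ => (x θ).re, fun θ => (-l * x θ + y θ).re, fun θ => hred _ _ _ (hx θ), ?_, ?_, ?_, ?_, ?_⟩
  · intro θ
    have h := hred _ _ _ (((hx θ).const_mul (-l)).add (hy θ))
    refine h.congr_deriv ?_
    have : (-l * (-l * x θ + y θ) + (l * y θ + (R θ : ℂ))) = (k : ℂ) * x θ + R θ := by
      rw [← hl]; ring
    rw [this]; simp
  · intro θ; simp only [hxp]
  · intro θ; simp only [hxp, hyp]
  · exact hre x hxc hx0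
  · apply hre _ (by fun_prop)
    rw [integral_add ((hxc.const_mul _).intervalIntegrable _ _) (hyc.intervalIntegrable _ _),
      integral_const_mul, hx0, hy0]; simp

lemma rolle_bound (W w w' : ℝ → ℝ) (M : ℝ) (hW : ∀ θ, HasDerivAt W (w θ) θ)
    (hp : ∀ θ, W (θ + 2 * π) = W θ) (hw : ∀ θ, HasDerivAt w (w' θ) θ) (hM : ∀ θ, |w' θ| ≤ M)
    (θ : ℝ) : |w θ| ≤ 2 * π * M := by
  have hpi := Real.pi_pos
  obtain ⟨x, hx, hx0⟩ := exists_hasDerivAt_eq_zero (f := W) (f' := w) (a := θ) (b := θ + 2 * π)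
    (by linarith) (continuous_iff_continuousAt.mpr fun t => (hW t).continuousAt).continuousOn
    (hp θ).symm (fun t _ => hW t)
  have h := Convex.norm_image_sub_le_of_norm_hasDerivWithin_le (f := w) (f' := w') (s := Set.univ)
    (C := M) (x := x) (y := θ) (fun t _ => (hw t).hasDerivWithinAt) (fun t _ => hM t) convex_univ
    (Set.mem_univ _) (Set.mem_univ _)
  rw [hx0, sub_zero, Real.norm_eq_abs, Real.norm_eq_abs] at h
  have hM0 : 0 ≤ M := (abs_nonneg _).trans (hM 0)
  have h2 : |θ - x| ≤ 2 * π := by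
    rw [abs_le]; constructor <;> linarith [hx.1, hx.2]
  calc _ ≤ _ := h
    _ ≤ M * (2 * π) := by gcongr
    _ = _ := by ring

lemma norm_fc_le {a b : ℝ} (hab : a < b) (f : ℝ → ℂ) (M : ℝ) (hM : ∀ x, ‖f x‖ ≤ M) (n : ℤ) :
    ‖fourierCoeffOn hab f n‖ ≤ M := by
  rw [fourierCoeffOn_eq_integral, norm_smul]
  have h : ‖∫ x in a..b, fourier (-n) (x : AddCircle (b - a)) • f x‖ ≤ M * |b - a| := by
    apply norm_integral_le_of_norm_le_const
    intro x _
    rw [norm_smul, fourier_apply, Circle.norm_coe, one_mul]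
    exact hM x
  have hb : 0 < b - a := sub_pos.mpr hab
  rw [abs_of_pos hb] at h
  rw [Real.norm_eq_abs, abs_of_pos (by positivity)]
  calc _ ≤ 1 / (b - a) * (M * (b - a)) := by gcongr
    _ = M := by field_simp

lemma sup_bound (m : ℝ) (hm : 0 < m) : ∃ K : ℝ, 0 ≤ K ∧ ∀ k : ℝ, m - 1 ≤ k → ∀ (u v R : ℝ → ℝ) (M : ℝ),
    Continuous R → (∀ θ, HasDerivAt u (v θ) θ) → (∀ θ, HasDerivAt v (k * u θ + R θ) θ) →
      (∀ θ, u (θ + 2 * π) = u θ) → 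
      (∫ θ in (0:ℝ)..(2*π), u θ) = 0 → (∀ θ, |R θ| ≤ M) → ∀ θ, |u θ| ≤ K * M := by
  set c := min m 1 with hc
  have hc0 : 0 < c := lt_min hm one_pos
  have hsum : Summable (fun n : ℤ => 1 / (n : ℝ) ^ 2) := Real.summable_one_div_int_pow.mpr (by norm_num)
  refine ⟨(1 / c) * ∑' n : ℤ, 1 / (n : ℝ) ^ 2, by positivity, ?_⟩
  intro k hk u v R M hR hu hv hup hu0 hM θ
  have hvp : ∀ θ, v (θ + 2 * π) = v θ := by
    intro t
    have h1 : HasDerivAt (fun s => u (s + 2 * π)) (v (t + 2 * π)) t :=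
      (hu (t + 2 * π)).comp_add_const t (2 * π)
    have h2 : (fun s => u (s + 2 * π)) = u := funext hup
    rw [h2] at h1
    exact h1.unique (hu t)
  have huc : Continuous u := continuous_iff_continuousAt.mpr fun t => (hu t).continuousAt
  have hvc : Continuous v := continuous_iff_continuousAt.mpr fun t => (hv t).continuousAt
  have hT : Fact (0 < 2 * π) := ⟨by positivity⟩
  have h02 : (0:ℝ) < 2 * π := hT.out
  have hpi : (π : ℂ) ≠ 0 := by simp [Real.pi_ne_zero]
  -- coefficient relation
  have step : ∀ (p q : ℝ → ℝ) (n : ℤ), n ≠ 0 → (∀ θ, HasDerivAt p (q θ) θ) → Continuous q → p (2 * π) = p 0 →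
      Complex.I * n * fourierCoeffOn h02 (fun t => (p t : ℂ)) n = fourierCoeffOn h02 (fun t => (q t : ℂ)) n := by
    intro p q n hn hp hq hpp
    have hn' : (n : ℂ) ≠ 0 := by exact_mod_cast hn
    rw [fourierCoeffOn_of_hasDerivAt h02 (f' := fun t => (q t : ℂ)) hn
      (fun x _ => (hp x).ofReal_comp) ((by fun_prop : Continuous fun t => (q t : ℂ)).intervalIntegrable _ _), hpp]
    push_cast
    field_simp
    ring_nf
  have hadd : ∀ n : ℤ, fourierCoeffOn h02 (fun t => ((k * u t + R t : ℝ) : ℂ)) n =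
      k * fourierCoeffOn h02 (fun t => (u t : ℂ)) n + fourierCoeffOn h02 (fun t => (R t : ℂ)) n := by
    intro n
    have hf : Continuous fun x : ℝ => fourier (-n) (x : AddCircle (2 * π - 0)) :=
      (map_continuous _).comp (AddCircle.continuous_mk' _)
    simp only [fourierCoeffOn_eq_integral, smul_eq_mul]
    have : ∀ x : ℝ, fourier (-n) (x : AddCircle (2 * π - 0)) * ((k * u x + R x : ℝ) : ℂ) =
      k * (fourier (-n) (x : AddCircle (2 * π - 0)) * (u x : ℂ)) + fourier (-n) (x : AddCircle (2 * π - 0)) * (R x : ℂ) := by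
      intro x; push_cast; ring
    simp_rw [this]
    rw [integral_add ((by fun_prop : Continuous _).intervalIntegrable _ _) ((by fun_prop : Continuous _).intervalIntegrable _ _),
      integral_const_mul, smul_add, mul_smul_comm]
  have hco : ∀ n : ℤ, ‖fourierCoeffOn h02 (fun t => (u t : ℂ)) n‖ ≤ (M / c) * (1 / (n : ℝ) ^ 2) := by
    intro n
    by_cases hn : n = 0
    · subst hn
      rw [fourierCoeffOn_eq_integral]
      simp [intervalIntegral.integral_ofReal, hu0]
    · have e1 := step u v n hn hu hvc (by simpa using hup 0)
      have e2 := step v (fun t => k * u t + R t) n hn hv (by fun_prop) (by simpa using hvp 0)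
      rw [hadd, ← e1] at e2
      have e3 : -(((n : ℝ) ^ 2 + k : ℝ) : ℂ) * fourierCoeffOn h02 (fun t => (u t : ℂ)) n =
          fourierCoeffOn h02 (fun t => (R t : ℂ)) n := by
        push_cast
        linear_combination e2 - (n : ℂ) ^ 2 * fourierCoeffOn h02 (fun t => (u t : ℂ)) n * Complex.I_sq
      have e4 := norm_fc_le h02 (fun t => (R t : ℂ)) M (fun x => by simpa using hM x) n
      rw [← e3, norm_mul, norm_neg, Complex.norm_real, Real.norm_eq_abs] at e4
      have hn1 : (1 : ℝ) ≤ (n : ℝ) ^ 2 := by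
        have : 1 ≤ n ^ 2 := by
          have := sq_pos_of_ne_zero hn
          omega
        exact_mod_cast this
      have hlow : c * (n : ℝ) ^ 2 ≤ (n : ℝ) ^ 2 + k := by
        have h1 : c ≤ m := min_le_left _ _
        have h2 : c ≤ 1 := min_le_right _ _
        nlinarith
      have hpos : 0 < c * (n : ℝ) ^ 2 := by positivity
      have e5 : c * (n : ℝ) ^ 2 * ‖fourierCoeffOn h02 (fun t => (u t : ℂ)) n‖ ≤ M := by
        refine le_trans ?_ e4
        gcongr
        exact hlow.trans (le_abs_self _)
      rw [div_mul_div_comm, mul_one, le_div_iff₀ hpos]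
      linarith
  -- lift
  have hper : Function.Periodic (fun t => (u t : ℂ)) (2 * π) := fun t => by simp [hup]
  let F : C(AddCircle (2 * π), ℂ) := ⟨hper.lift, by
    apply continuous_coinduced_dom.mpr
    change Continuous fun t => (u t : ℂ)
    fun_prop⟩
  have hFu : ∀ t : ℝ, F (t : AddCircle (2 * π)) = u t := fun t => rfl
  have hFc : ∀ n, fourierCoeff F n = fourierCoeffOn h02 (fun t => (u t : ℂ)) n := by
    intro n
    rw [fourierCoeffOn_eq_integral, fourierCoeff_eq_intervalIntegral F n 0]
    simp only [zero_add, hFu, fourier_coe_apply, sub_zero]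
  have hs2 : Summable (fun n : ℤ => (M / c) * (1 / (n : ℝ) ^ 2)) := hsum.mul_left _
  have hsF : Summable (fourierCoeff F) := by
    apply Summable.of_norm_bounded hs2
    intro n; rw [hFc]; exact hco n
  have h := has_pointwise_sum_fourier_series_of_summable hsF (θ : AddCircle (2 * π))
  have hle := tsum_of_norm_bounded (f := fun i => fourierCoeff F i • fourier i (θ : AddCircle (2 * π))) hs2.hasSum (by
    intro n
    rw [norm_smul, fourier_apply, Circle.norm_coe, mul_one, hFc]
    exact hco n)
  rw [h.tsum_eq, hFu, Complex.norm_real, Real.norm_eq_abs, tsum_mul_left] at hle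
  calc _ ≤ _ := hle
    _ = _ := by ring

lemma antideriv (R : ℝ → ℝ)
    (hR : Continuous R) (hp : ∀ θ, R (θ + 2 * π) = R θ) (h0 : (∫ θ in (0:ℝ)..(2*π), R θ) = 0) :
    ∃ p : ℝ → ℝ, (∀ θ, HasDerivAt p (R θ) θ) ∧ (∀ θ, p (θ + 2 * π) = p θ) ∧
      (∫ θ in (0:ℝ)..(2*π), p θ) = 0 ∧
      (∀ M, (∀ θ, |R θ| ≤ M) → ∀ θ, |p θ| ≤ 2 * π * M) := by
  obtain ⟨u, v, hu, hv, hup, hvp, -, hv0⟩ := second_order 0 (by norm_num) R hR hp h0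
  have hv' : ∀ θ, HasDerivAt v (R θ) θ := fun θ => (hv θ).congr_deriv (by ring)
  exact ⟨v, hv', hvp, hv0, fun M hM θ => rolle_bound u v R M hu hup hv' hM θ⟩

lemma cont_of_hasDeriv {f f' : ℝ → ℝ} (h : ∀ θ, HasDerivAt f (f' θ) θ) : Continuous f :=
  continuous_iff_continuousAt.mpr fun t => (h t).continuousAt

lemma deriv_eq_of {f f' : ℝ → ℝ} (h : ∀ θ, HasDerivAt f (f' θ) θ) : deriv f = f' :=
  funext fun t => (h t).deriv

lemma contDiff_two_of {f f' f'' : ℝ → ℝ} (h : ∀ θ, HasDerivAt f (f' θ) θ)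
    (h' : ∀ θ, HasDerivAt f' (f'' θ) θ) (hc : Continuous f'') : ContDiff ℝ 2 f := by
  have h1 : ContDiff ℝ 1 f' := by
    rw [contDiff_one_iff_deriv, deriv_eq_of h']
    exact ⟨fun t => (h' t).differentiableAt, hc⟩
  have : (2 : WithTop ℕ∞) = 1 + 1 := by norm_num
  rw [this, contDiff_succ_iff_deriv, deriv_eq_of h]
  exact ⟨fun t => (h t).differentiableAt, by simp, h1⟩

lemma hasDeriv_of_contDiff {f : ℝ → ℝ} (h : ContDiff ℝ 2 f) :
    (∀ θ, HasDerivAt f (deriv f θ) θ) ∧ (∀ θ, HasDerivAt (deriv f) (deriv (deriv f) θ) θ) ∧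
      Continuous (deriv (deriv f)) := by
  have : (2 : WithTop ℕ∞) = 1 + 1 := by norm_num
  rw [this, contDiff_succ_iff_deriv] at h
  obtain ⟨h1, -, h2⟩ := h
  rw [contDiff_one_iff_deriv] at h2
  exact ⟨fun θ => (h1 θ).hasDerivAt, fun θ => (h2.1 θ).hasDerivAt, h2.2⟩

lemma periodic_deriv {u v : ℝ → ℝ} (hu : ∀ θ, HasDerivAt u (v θ) θ)
    (hup : ∀ θ, u (θ + 2 * π) = u θ) : ∀ θ, v (θ + 2 * π) = v θ := by
  intro t
  have h1 : HasDerivAt (fun s => u (s + 2 * π)) (v (t + 2 * π)) t :=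
    (hu (t + 2 * π)).comp_add_const t (2 * π)
  have h2 : (fun s => u (s + 2 * π)) = u := funext hup
  rw [h2] at h1
  exact h1.unique (hu t)

lemma integral_deriv_zero {u v : ℝ → ℝ} (hu : ∀ θ, HasDerivAt u (v θ) θ) (hv : Continuous v)
    (hup : ∀ θ, u (θ + 2 * π) = u θ) : (∫ θ in (0:ℝ)..(2*π), v θ) = 0 := by
  rw [integral_eq_sub_of_hasDerivAt (fun t _ => hu t) (hv.intervalIntegrable _ _)]
  have := hup 0
  rw [zero_add] at this
  rw [this, sub_self]

/-- The homogeneous system has only the trivial solution. -/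
lemma homog_zero (m d : ℝ) (hm : 0 < m) (hd : m + 1 < d) (f f1 f2 g g1 g2 : ℝ → ℝ)
    (hf : ∀ θ, HasDerivAt f (f1 θ) θ) (hf1 : ∀ θ, HasDerivAt f1 (f2 θ) θ)
    (hg : ∀ θ, HasDerivAt g (g1 θ) θ) (hg1 : ∀ θ, HasDerivAt g1 (g2 θ) θ)
    (hf2 : Continuous f2)
    (hfp : ∀ θ, f (θ + 2 * π) = f θ) (hgp : ∀ θ, g (θ + 2 * π) = g θ)
    (e1 : ∀ θ, -(m + 1) * f θ + (f2 θ - g1 θ) + d * (f θ + g1 θ) = 0)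
    (e2 : ∀ θ, f1 θ - d * (f1 θ + g2 θ) = 0) (hg0 : (∫ θ in (0:ℝ)..(2*π), g θ) = 0) :
    (∀ θ, f θ = 0) ∧ (∀ θ, g θ = 0) := by
  have hpi := Real.pi_pos
  have hd0 : 0 < d := by linarith
  have hfc := cont_of_hasDeriv hf
  have hgc := cont_of_hasDeriv hg
  have hg1c := cont_of_hasDeriv hg1
  have hD : ∀ t, HasDerivAt (fun s => f s - d * (f s + g1 s)) 0 t := fun t =>
    ((hf t).sub (((hf t).add (hg1 t)).const_mul d)).congr_deriv (e2 t)
  set c := f 0 - d * (f 0 + g1 0) with hcdef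
  have hc : ∀ t, f t - d * (f t + g1 t) = c := fun t =>
    is_const_of_deriv_eq_zero (fun t => (hD t).differentiableAt) (fun t => (hD t).deriv) t 0
  have hig1 := integral_deriv_zero hg hg1c hgp
  have hif2 := integral_deriv_zero hf1 hf2 (periodic_deriv hf hfp)
  set A := ∫ θ in (0:ℝ)..(2*π), f θ with hA
  have i1 : (1 - d) * A = 2 * π * c := by
    have h1 : (∫ θ in (0:ℝ)..(2*π), ((1 - d) * f θ + (-d) * g1 θ)) = ∫ θ in (0:ℝ)..(2*π), c := by
      congr 1; ext t; rw [← hc t]; ring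
    rw [integral_add ((by fun_prop : Continuous _).intervalIntegrable _ _)
      ((by fun_prop : Continuous _).intervalIntegrable _ _), integral_const_mul,
      integral_const_mul, hig1, ← hA] at h1
    simpa using h1
  have i2 : -m * A = 2 * π * c := by
    have h1 : (∫ θ in (0:ℝ)..(2*π), ((-m) * f θ + (f2 θ - g1 θ))) = ∫ θ in (0:ℝ)..(2*π), c := by
      congr 1; ext t; linarith [hc t, e1 t]
    rw [integral_add ((by fun_prop : Continuous _).intervalIntegrable _ _)
      ((by fun_prop : Continuous _).intervalIntegrable _ _), integral_const_mul,
      integral_sub (hf2.intervalIntegrable _ _) (hg1c.intervalIntegrable _ _), hig1, hif2, ← hA] at h1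
    simpa using h1
  have hA0 : A = 0 := by
    have : (d - 1 - m) * A = 0 := by linarith
    exact (mul_eq_zero.mp this).resolve_left (by linarith)
  have hc0 : c = 0 := by
    rw [hA0] at i2
    have : 2 * π * c = 0 := by linarith
    exact (mul_eq_zero.mp this).resolve_left (by positivity)
  have hg1' : ∀ t, g1 t = f t / d - f t := by
    intro t
    have := hc t
    rw [hc0] at this
    field_simp
    linarith
  obtain ⟨K, hK, hb⟩ := sup_bound m hm
  have hf0 : ∀ θ, f θ = 0 := by
    intro θ
    have := hb (m - 1 + 1 / d) (by have : 0 < 1 / d := by positivity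
                                   linarith) f f1 (fun _ => 0) 0 continuous_const hf
      (fun t => (hf1 t).congr_deriv (by
        have h1 := e1 t
        have h2 := hc t
        rw [hc0] at h2
        have h3 := hg1' t
        have : f2 t = m * f t + g1 t := by linarith
        rw [this, h3]; ring)) hfp hA0 (by simp) θ
    rw [mul_zero] at this
    exact abs_nonpos_iff.mp this
  refine ⟨hf0, ?_⟩
  have hgd : ∀ t, HasDerivAt g 0 t := fun t => (hg t).congr_deriv (by rw [hg1', hf0]; simp)
  have hgcst : ∀ t, g t = g 0 := fun t =>
    is_const_of_deriv_eq_zero (fun t => (hgd t).differentiableAt) (fun t => (hgd t).deriv) t 0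
  have : (∫ θ in (0:ℝ)..(2*π), g θ) = ∫ θ in (0:ℝ)..(2*π), g 0 := by
    congr 1; ext t; exact hgcst t
  rw [hg0] at this
  intro t
  rw [hgcst t]
  simpa [hpi.ne'] using this.symm

theorem stmt_18 (m : ℝ) (hm : 0 < m) :
    ∃ C d₀ : ℝ, 0 < C ∧
      ∀ dhat : ℝ, m + 1 < dhat →
        ∀ φ ψ : ℝ → ℝ, Continuous φ → Continuous ψ →
          (∀ θ : ℝ, φ (θ + 2 * π) = φ θ) → (∀ θ : ℝ, ψ (θ + 2 * π) = ψ θ) →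
          (∫ θ in (0 : ℝ)..(2 * π), ψ θ) = 0 →
          ∃ f g : ℝ → ℝ,
            IsPeriodicSol m dhat φ ψ f g ∧
            (∀ f' g' : ℝ → ℝ, IsPeriodicSol m dhat φ ψ f' g' → f' = f ∧ g' = g) ∧
            (d₀ ≤ dhat →
              ∀ Mφ Mψ : ℝ, (∀ θ : ℝ, |φ θ| ≤ Mφ) → (∀ θ : ℝ, |ψ θ| ≤ Mψ) →
                ∀ θ : ℝ,
                  |f θ| + |deriv f θ| + |deriv (deriv f) θ|
                    + |g θ| + |deriv g θ| + |deriv (deriv g) θ|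
                  ≤ C * (Mφ + Mψ)) := by
  have hpi := Real.pi_pos
  have hpi3 := Real.pi_gt_three
  obtain ⟨K, hK, hb⟩ := sup_bound m hm
  set B : ℝ := K * (2 * π) with hB
  have hB0 : 0 ≤ B := by positivity
  set A : ℝ := (m + 1) * B + 2 * π with hA
  have hA0 : 0 ≤ A := by positivity
  refine ⟨(1 + B) + 2 * π * A + A + 2 * π * (2 * B + 2 * π) + (2 * B + 2 * π) + (2 * (2 * π * A) + 1),
    m + 2, by positivity, ?_⟩
  intro d hd φ ψ hφ hψ hφp hψp hψ0
  have hd0 : 0 < d := by linarith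
  have hd1 : 1 / d ≤ 1 := by rw [div_le_one hd0]; linarith
  have hdp : 0 < 1 / d := by positivity
  obtain ⟨Ψ, hΨ, hΨp, hΨ0, hΨb⟩ := antideriv ψ hψ hψp hψ0
  have hΨc := cont_of_hasDeriv hΨ
  set μ : ℝ := (∫ θ in (0 : ℝ)..(2 * π), φ θ) / (2 * π) with hμ
  set F : ℝ := μ / (d - 1 - m) with hF
  have hFμ : (d - 1 - m) * F = μ := by
    have : d - 1 - m ≠ 0 := by linarith
    rw [hF]; field_simp
  set k : ℝ := m - 1 + 1 / d with hk
  set R : ℝ → ℝ := fun θ => (φ θ - μ) + (1 - 1 / d) * Ψ θ with hR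
  have hRc : Continuous R := by fun_prop
  have hR0 : (∫ θ in (0 : ℝ)..(2 * π), R θ) = 0 := by
    simp only [hR]
    rw [integral_add ((by fun_prop : Continuous _).intervalIntegrable _ _)
      ((by fun_prop : Continuous _).intervalIntegrable _ _), integral_const_mul, hΨ0,
      integral_sub (hφ.intervalIntegrable _ _) (by simp)]
    simp [hμ]
  obtain ⟨u, v, hu, hv, hup, hvp, hu0, hv0⟩ := second_order k (by linarith) R hRc
    (fun θ => by simp [hR, hφp, hΨp]) hR0
  have huc := cont_of_hasDeriv hu
  have hvc := cont_of_hasDeriv hv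
  set G : ℝ → ℝ := fun θ => (1 / d) * (u θ - Ψ θ) - u θ with hG
  have hGd : ∀ θ, HasDerivAt G ((1 / d) * (v θ - ψ θ) - v θ) θ := fun θ =>
    (((hu θ).sub (hΨ θ)).const_mul (1 / d)).sub (hu θ)
  have hGc := cont_of_hasDeriv hGd
  have hG0 : (∫ θ in (0 : ℝ)..(2 * π), G θ) = 0 := by
    simp only [hG]
    rw [integral_sub ((by fun_prop : Continuous _).intervalIntegrable _ _)
      (huc.intervalIntegrable _ _), integral_const_mul,
      integral_sub (huc.intervalIntegrable _ _) (hΨc.intervalIntegrable _ _), hu0, hΨ0]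
    simp
  obtain ⟨g, hg, hgp, hg0, hgb⟩ := antideriv G hGc (fun θ => by simp [hG, hup, hΨp]) hG0
  set f : ℝ → ℝ := fun θ => F + u θ with hf
  have hfd : ∀ θ, HasDerivAt f (v θ) θ := fun θ => (hu θ).const_add F
  have df := deriv_eq_of hfd
  have dv := deriv_eq_of hv
  have dg := deriv_eq_of hg
  have dG := deriv_eq_of hGd
  have hsol : IsPeriodicSol m d φ ψ f g := by
    refine ⟨contDiff_two_of hfd hv (by fun_prop), contDiff_two_of hg hGd (by fun_prop),
      fun θ => by simp [hf, hup], hgp, ?_, ?_, hg0⟩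
    · intro θ
      rw [df, dv, dg]
      simp only [hf, hG, hR, hk]
      have h1 : d * (1 / d) = 1 := by field_simp
      linear_combination hFμ + (u θ - Ψ θ) * h1
    · intro θ
      rw [df, dg, dG]
      have h1 : d * (1 / d) = 1 := by field_simp
      linear_combination (-(v θ - ψ θ)) * h1
  refine ⟨f, g, hsol, ?_, ?_⟩
  · intro p q ⟨hp, hq, hpp, hqp, e1, e2, hq0⟩
    obtain ⟨hp1, hp2, hp3⟩ := hasDeriv_of_contDiff hp
    obtain ⟨hq1, hq2, hq3⟩ := hasDeriv_of_contDiff hq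
    obtain ⟨hf, hg, hfp, hgp, s1, s2, -⟩ := hsol
    obtain ⟨hf1, hf2, hf3⟩ := hasDeriv_of_contDiff hf
    obtain ⟨hg1, hg2, hg3⟩ := hasDeriv_of_contDiff hg
    have := homog_zero m d hm hd _ _ _ _ _ _ (fun θ => (hp1 θ).sub (hf1 θ))
      (fun θ => (hp2 θ).sub (hf2 θ)) (fun θ => (hq1 θ).sub (hg1 θ)) (fun θ => (hq2 θ).sub (hg2 θ))
      (hp3.sub hf3) (fun θ => by simp only [Pi.sub_apply, hpp, hfp])
      (fun θ => by simp only [Pi.sub_apply, hqp, hgp])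
      (fun θ => by simp only [Pi.sub_apply]; linarith [e1 θ, s1 θ])
      (fun θ => by linarith [e2 θ, s2 θ])
      (by
        simp only [Pi.sub_apply]
        rw [integral_sub (hq.continuous.intervalIntegrable _ _)
          (hg.continuous.intervalIntegrable _ _), hq0, hg0, sub_self])
    exact ⟨funext fun θ => sub_eq_zero.mp (this.1 θ), funext fun θ => sub_eq_zero.mp (this.2 θ)⟩
  · intro hdd Mφ Mψ hMφ hMψ θ
    have hφ0 : 0 ≤ Mφ := (abs_nonneg _).trans (hMφ 0)
    have hψ0 : 0 ≤ Mψ := (abs_nonneg _).trans (hMψ 0)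
    set S := Mφ + Mψ with hS
    have hS0 : 0 ≤ S := by positivity
    have bΨ : ∀ θ, |Ψ θ| ≤ 2 * π * Mψ := hΨb Mψ hMψ
    have bμ : |μ| ≤ Mφ := by
      have h := norm_integral_le_of_norm_le_const (a := 0) (b := 2 * π) (f := φ) (C := Mφ)
        (fun x _ => hMφ x)
      rw [sub_zero, abs_of_pos (by positivity : 0 < 2 * π), Real.norm_eq_abs] at h
      rw [hμ, abs_div, abs_of_pos (by positivity : 0 < 2 * π), div_le_iff₀ (by positivity)]
      exact h
    have bF : |F| ≤ S := by
      have h1 : 1 ≤ d - 1 - m := by linarith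
      rw [hF, abs_div, abs_of_pos (by linarith : 0 < d - 1 - m)]
      exact (div_le_self (abs_nonneg _) h1).trans (by linarith)
    have bR : ∀ θ, |R θ| ≤ 2 * π * S := by
      intro θ
      have h1 : |(1 - 1 / d) * Ψ θ| ≤ 2 * π * Mψ := by
        rw [abs_mul, abs_of_nonneg (by linarith : 0 ≤ 1 - 1 / d)]
        calc _ ≤ 1 * |Ψ θ| := by gcongr; linarith
          _ ≤ _ := by rw [one_mul]; exact bΨ θ
      have h2 : |φ θ - μ| ≤ Mφ + Mφ := (abs_sub _ _).trans (add_le_add (hMφ θ) bμ)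
      calc |R θ| ≤ _ := abs_add_le _ _
        _ ≤ (Mφ + Mφ) + 2 * π * Mψ := add_le_add h2 h1
        _ ≤ _ := by rw [hS]; nlinarith
    have bu : ∀ θ, |u θ| ≤ B * S := by
      intro θ
      have := hb k (by linarith) u v R (2 * π * S) hRc hu hv hup hu0 bR θ
      rw [hB]; linarith
    have bk : |k| ≤ m + 1 := by rw [abs_le]; constructor <;> linarith
    have bu2 : ∀ θ, |k * u θ + R θ| ≤ A * S := by
      intro θ
      calc _ ≤ |k * u θ| + |R θ| := abs_add_le _ _
        _ ≤ (m + 1) * (B * S) + 2 * π * S := by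
          rw [abs_mul]
          have := bu θ
          have := bR θ
          gcongr
        _ = _ := by rw [hA]; ring
    have bv : ∀ θ, |v θ| ≤ 2 * π * (A * S) := rolle_bound u v _ _ hu hup hv bu2
    have bd : ∀ x y : ℝ, |1 / d * (x - y) - x| ≤ 2 * |x| + |y| := by
      intro x y
      calc _ ≤ |1 / d * (x - y)| + |x| := abs_sub _ _
        _ ≤ 1 * (|x| + |y|) + |x| := by
          rw [abs_mul, abs_of_pos hdp]
          gcongr
          exact abs_sub _ _
        _ = _ := by ring
    have bG : ∀ θ, |G θ| ≤ (2 * B + 2 * π) * S := by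
      intro θ
      have h1 := bd (u θ) (Ψ θ)
      have h2 := bu θ
      have h3 := bΨ θ
      have h4 : 2 * π * Mψ ≤ 2 * π * S := by gcongr; linarith
      calc _ ≤ _ := h1
        _ ≤ _ := by linarith
    have bg := hgb _ bG θ
    have bG1 : |1 / d * (v θ - ψ θ) - v θ| ≤ (2 * (2 * π * A) + 1) * S := by
      have h1 := bd (v θ) (ψ θ)
      have h2 := bv θ
      have h3 := hMψ θ
      calc _ ≤ _ := h1
        _ ≤ _ := by linarith
    have bf : |f θ| ≤ (1 + B) * S := by
      have h := bu θ
      calc _ ≤ |F| + |u θ| := abs_add_le _ _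
        _ ≤ _ := by linarith
    rw [df, dv, dg, dG]
    have h1 := bv θ
    have h2 := bu2 θ
    have h3 := bG θ
    linarith
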